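/- For every t > 0 and every x, y ∈ E, one has the identity (in [0,∞]): ∫₀^t q(s,x,y) ds = ∫₀^t G^{(S)}(t−s) p(s,x,y) ds. -/

import Mathlib

open MeasureTheory Filter Set
open scoped ENNReal Topology

/-- Two finite measures on `ℝ` whose two-sided Laplace transforms agree as `[0,∞]`-valued functions
and are finite near the origin are equal. -/
theorem MeasureTheory.Measure.ext_of_lintegral_exp_eq {μ μ' : Measure ℝ} [IsFiniteMeasure μ] [IsFiniteMeasure μ']
    (h : ∀ s : ℝ, ∫⁻ x, ENNReal.ofReal (Real.exp (s * x)) ∂μ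
      = ∫⁻ x, ENNReal.ofReal (Real.exp (s * x)) ∂μ')
    (hfin : ∀ᶠ s : ℝ in 𝓝 0, ∫⁻ x, ENNReal.ofReal (Real.exp (s * x)) ∂μ ≠ ⊤) :
    μ = μ' := by
  have hmgf : ProbabilityTheory.mgf id μ = ProbabilityTheory.mgf id μ' := by
    ext s
    simp only [ProbabilityTheory.mgf, id]
    rw [integral_eq_lintegral_of_nonneg_ae (ae_of_all _ fun x => (Real.exp_pos _).le)
        (by fun_prop),
      integral_eq_lintegral_of_nonneg_ae (ae_of_all _ fun x => (Real.exp_pos _).le)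
        (by fun_prop), h s]
  have hzero : μ = 0 ↔ μ' = 0 := by
    have h0 := h 0
    simp only [zero_mul, Real.exp_zero, ENNReal.ofReal_one, lintegral_one] at h0
    rw [← Measure.measure_univ_eq_zero, h0, Measure.measure_univ_eq_zero]
  have hint : (0 : ℝ) ∈ interior (ProbabilityTheory.integrableExpSet id μ) := by
    rw [mem_interior_iff_mem_nhds]
    filter_upwards [hfin] with s hs
    refine (lintegral_ofReal_ne_top_iff_integrable (by fun_prop)
      (ae_of_all _ fun x => (Real.exp_pos _).le)).1 hs
  refine Measure.ext_of_charFun (funext fun t => ?_)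
  rw [← ProbabilityTheory.complexMGF_id_mul_I, ← ProbabilityTheory.complexMGF_id_mul_I]
  exact ProbabilityTheory.eqOn_complexMGF_of_mgf' hmgf hzero (by simpa using hint)

theorem lintegral_exp_neg_mul_Ioi {l : ℝ} (hl : 0 < l) :
    ∫⁻ t in Ioi (0:ℝ), ENNReal.ofReal (Real.exp (-l * t)) = ENNReal.ofReal (1 / l) := by
  rw [← ofReal_integral_eq_lintegral_ofReal (integrableOn_exp_mul_Ioi (neg_lt_zero.2 hl) 0)
    (ae_of_all _ fun x => (Real.exp_pos _).le), integral_exp_mul_Ioi (neg_lt_zero.2 hl)]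
  congr 1
  simp

/-- If the Laplace transform of `f` is `1 / l`, this computes the two-sided Laplace transform of the
measure `exp (-t) f(t) dt` on `(0,∞)`. -/
theorem lintegral_exp_withDensity_of_laplace {f : ℝ → ℝ≥0∞} (hf : Measurable f)
    (h : ∀ l : ℝ, 0 < l →
      ∫⁻ t in Ioi (0:ℝ), ENNReal.ofReal (Real.exp (-l * t)) * f t = ENNReal.ofReal (1 / l))
    (s : ℝ) :
    ∫⁻ x, ENNReal.ofReal (Real.exp (s * x)) ∂((volume.restrict (Ioi (0:ℝ))).withDensity
      (fun t => ENNReal.ofReal (Real.exp (-t)) * f t))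
      = if s < 1 then ENNReal.ofReal (1 / (1 - s)) else ⊤ := by
  have key : ∫⁻ x, ENNReal.ofReal (Real.exp (s * x)) ∂((volume.restrict (Ioi (0:ℝ))).withDensity
      (fun t => ENNReal.ofReal (Real.exp (-t)) * f t))
      = ∫⁻ t in Ioi (0:ℝ), ENNReal.ofReal (Real.exp (-(1 - s) * t)) * f t := by
    rw [lintegral_withDensity_eq_lintegral_mul _ (by fun_prop) (by fun_prop)]
    refine lintegral_congr fun t => ?_
    simp only [Pi.mul_apply]
    rw [mul_right_comm, ← ENNReal.ofReal_mul (Real.exp_pos _).le, ← Real.exp_add]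
    ring_nf
  rw [key]
  split_ifs with hs
  · exact h _ (by linarith)
  · refine ENNReal.eq_top_of_forall_nnreal_le fun r => ?_
    have hr : (0:ℝ) < 1 / (r + 1) := by positivity
    calc (r : ℝ≥0∞) ≤ ENNReal.ofReal (1 / (1 / ((r:ℝ) + 1))) := by
          rw [one_div_one_div, ← ENNReal.ofReal_coe_nnreal]
          exact ENNReal.ofReal_le_ofReal (by linarith)
      _ = ∫⁻ t in Ioi (0:ℝ), ENNReal.ofReal (Real.exp (-(1 / ((r:ℝ) + 1)) * t)) * f t :=
          (h _ hr).symm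
      _ ≤ _ := by
          refine setLIntegral_mono' measurableSet_Ioi fun t ht => ?_
          gcongr
          · exact (mem_Ioi.1 ht).le
          · linarith

/-- A nonnegative function on `(0,∞)` with Laplace transform `1 / l` equals `1` almost everywhere. -/
theorem ae_eq_one_of_laplace {f : ℝ → ℝ≥0∞} (hf : Measurable f)
    (h : ∀ l : ℝ, 0 < l →
      ∫⁻ t in Ioi (0:ℝ), ENNReal.ofReal (Real.exp (-l * t)) * f t = ENNReal.ofReal (1 / l)) :
    ∀ᵐ t ∂volume.restrict (Ioi (0:ℝ)), f t = 1 := by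
  have hone : ∀ l : ℝ, 0 < l → ∫⁻ t in Ioi (0:ℝ),
      ENNReal.ofReal (Real.exp (-l * t)) * (1 : ℝ → ℝ≥0∞) t = ENNReal.ofReal (1 / l) := by
    intro l hl
    simpa using! lintegral_exp_neg_mul_Ioi hl
  have hfin : ∀ g : ℝ → ℝ≥0∞, Measurable g → (∀ l : ℝ, 0 < l →
      ∫⁻ t in Ioi (0:ℝ), ENNReal.ofReal (Real.exp (-l * t)) * g t = ENNReal.ofReal (1 / l)) →
      IsFiniteMeasure ((volume.restrict (Ioi (0:ℝ))).withDensity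
        (fun t => ENNReal.ofReal (Real.exp (-t)) * g t)) := by
    intro g hg hgl
    refine isFiniteMeasure_withDensity ?_
    have := hgl 1 one_pos
    simp only [neg_mul, one_mul] at this
    rw [this]
    exact ENNReal.ofReal_ne_top
  have := hfin f hf h
  have := hfin 1 measurable_one hone
  have heq := Measure.ext_of_lintegral_exp_eq
    (μ := (volume.restrict (Ioi (0:ℝ))).withDensity
      (fun t => ENNReal.ofReal (Real.exp (-t)) * f t))
    (μ' := (volume.restrict (Ioi (0:ℝ))).withDensity
      (fun t => ENNReal.ofReal (Real.exp (-t)) * (1 : ℝ → ℝ≥0∞) t))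
    (fun s => by
      rw [lintegral_exp_withDensity_of_laplace hf h,
        lintegral_exp_withDensity_of_laplace measurable_one hone])
    (by
      filter_upwards [Iio_mem_nhds (zero_lt_one' ℝ)] with s hs
      rw [lintegral_exp_withDensity_of_laplace hf h, if_pos (mem_Iio.1 hs)]
      exact ENNReal.ofReal_ne_top)
  rw [withDensity_eq_iff_of_sigmaFinite (by fun_prop) (by fun_prop)] at heq
  filter_upwards [heq] with t ht
  exact (ENNReal.mul_right_inj (by simp [Real.exp_pos]) ENNReal.ofReal_ne_top).1 ht

/-- The two-sided Laplace transform turns convolution into multiplication. -/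
theorem lintegral_exp_mul_lconvolution {f g : ℝ → ℝ≥0∞} (hf : Measurable f) (hg : Measurable g)
    (l : ℝ) :
    ∫⁻ t, ENNReal.ofReal (Real.exp (-l * t)) * (f ⋆ₗ[volume] g) t
      = (∫⁻ t, ENNReal.ofReal (Real.exp (-l * t)) * f t)
        * ∫⁻ t, ENNReal.ofReal (Real.exp (-l * t)) * g t := by
  simp only [lconvolution_def]
  calc ∫⁻ t, ENNReal.ofReal (Real.exp (-l * t)) * ∫⁻ y, f y * g (-y + t)
      = ∫⁻ t, ∫⁻ y, ENNReal.ofReal (Real.exp (-l * t)) * (f y * g (-y + t)) := by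
        refine lintegral_congr fun t => (lintegral_const_mul _ (by fun_prop)).symm
    _ = ∫⁻ y, ∫⁻ t, ENNReal.ofReal (Real.exp (-l * t)) * (f y * g (-y + t)) :=
        lintegral_lintegral_swap (by fun_prop)
    _ = ∫⁻ y, (ENNReal.ofReal (Real.exp (-l * y)) * f y)
          * ∫⁻ t, ENNReal.ofReal (Real.exp (-l * t)) * g t := by
        refine lintegral_congr fun y => ?_
        rw [← lintegral_add_left_eq_self _ y, ← lintegral_const_mul _ (by fun_prop)]
        refine lintegral_congr fun t => ?_
        rw [neg_add_cancel_left, mul_add, Real.exp_add, ENNReal.ofReal_mul (Real.exp_pos _).le]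
        ring
    _ = _ := lintegral_mul_const _ (by fun_prop)

/-- On functions supported in `(0,∞)`, convolution is an integral over `(0,t)`. -/
theorem lconvolution_indicator_Ioi (f g : ℝ → ℝ≥0∞) (t : ℝ) :
    ((Ioi 0).indicator f ⋆ₗ[volume] (Ioi 0).indicator g) t
      = ∫⁻ s in Ioo 0 t, f (t - s) * g s := by
  rw [lconvolution_comm, lconvolution_def, ← lintegral_indicator measurableSet_Ioo]
  refine lintegral_congr fun s => ?_
  by_cases h1 : 0 < s <;> by_cases h2 : s < t <;>
    simp [h1, h2, mul_comm, sub_eq_neg_add]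

theorem lintegral_mul_indicator_Ioi (f g : ℝ → ℝ≥0∞) :
    ∫⁻ t, f t * (Ioi (0:ℝ)).indicator g t = ∫⁻ t in Ioi (0:ℝ), f t * g t := by
  rw [← lintegral_indicator measurableSet_Ioi]
  refine lintegral_congr fun t => ?_
  by_cases h : 0 < t <;> simp [h]

section LevyMeasure

variable {ν : Measure ℝ}

theorem measure_Ioi_ne_top_of_lintegral_min
    (hν : ∫⁻ x in Ioi (0:ℝ), ENNReal.ofReal (min 1 x) ∂ν ≠ ⊤) {t : ℝ} (ht : 0 < t) :
    ν (Ioi t) ≠ ⊤ := by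
  have h1 : ENNReal.ofReal (min 1 t) * ν (Ioi t) ≠ ⊤ := by
    refine ne_top_of_le_ne_top hν ?_
    calc ENNReal.ofReal (min 1 t) * ν (Ioi t)
        = ∫⁻ x in Ioi t, ENNReal.ofReal (min 1 t) ∂ν := by simp
      _ ≤ ∫⁻ x in Ioi t, ENNReal.ofReal (min 1 x) ∂ν :=
          setLIntegral_mono' measurableSet_Ioi fun x hx =>
            ENNReal.ofReal_le_ofReal (min_le_min_left _ (mem_Ioi.1 hx).le)
      _ ≤ _ := lintegral_mono_set (Ioi_subset_Ioi ht.le)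
  intro h
  rw [h] at h1
  exact h1 (ENNReal.mul_top (by simpa using ht))

theorem integrableOn_one_sub_exp
    (hν : ∫⁻ x in Ioi (0:ℝ), ENNReal.ofReal (min 1 x) ∂ν ≠ ⊤) {l : ℝ} (hl : 0 < l) :
    IntegrableOn (fun x => 1 - Real.exp (-l * x)) (Ioi 0) ν := by
  have hmin : IntegrableOn (fun x : ℝ => min 1 x) (Ioi 0) ν :=
    (lintegral_ofReal_ne_top_iff_integrable (by fun_prop)
      (ae_restrict_of_forall_mem measurableSet_Ioi fun x hx =>
        le_min zero_le_one (mem_Ioi.1 hx).le)).1 hν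
  refine (hmin.const_mul (max 1 l)).mono' (by fun_prop)
    (ae_restrict_of_forall_mem measurableSet_Ioi fun x hx => ?_)
  have hx : 0 < x := hx
  have h1 := Real.add_one_le_exp (-l * x)
  have h2 : Real.exp (-l * x) ≤ 1 := Real.exp_le_one_iff.2 (by nlinarith)
  have h3 := Real.exp_pos (-l * x)
  rw [Real.norm_of_nonneg (by linarith)]
  rcases min_cases 1 x with ⟨h, -⟩ | ⟨h, -⟩ <;> rw [h]
  · linarith [le_max_left 1 l]
  · nlinarith [le_max_right 1 l]

theorem integral_one_sub_exp_pos
    (hν : ∫⁻ x in Ioi (0:ℝ), ENNReal.ofReal (min 1 x) ∂ν ≠ ⊤) (hν_pos : ν (Ioi (0:ℝ)) ≠ 0)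
    {l : ℝ} (hl : 0 < l) :
    0 < ∫ x in Ioi (0:ℝ), (1 - Real.exp (-l * x)) ∂ν := by
  have hpos : ∀ x ∈ Ioi (0:ℝ), 0 < 1 - Real.exp (-l * x) := fun x hx =>
    sub_pos.2 (Real.exp_lt_one_iff.2 (by nlinarith [mem_Ioi.1 hx]))
  rw [setIntegral_pos_iff_support_of_nonneg_ae
    (ae_restrict_of_forall_mem measurableSet_Ioi fun x hx => (hpos x hx).le)
    (integrableOn_one_sub_exp hν hl),
    inter_eq_right.2 (fun x hx => Function.mem_support.2 (hpos x hx).ne')]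
  exact pos_iff_ne_zero.2 hν_pos

/-- The Laplace transform of the tail of a Lévy measure. -/
theorem lintegral_exp_mul_tail
    (hν : ∫⁻ x in Ioi (0:ℝ), ENNReal.ofReal (min 1 x) ∂ν ≠ ⊤) {l : ℝ} (hl : 0 < l) :
    ∫⁻ t in Ioi (0:ℝ), ENNReal.ofReal (Real.exp (-l * t)) * ENNReal.ofReal (ν (Ioi t)).toReal
      = ENNReal.ofReal ((∫ x in Ioi (0:ℝ), (1 - Real.exp (-l * x)) ∂ν) / l) := by
  have hcake := lintegral_comp_eq_lintegral_meas_lt_mul (ν.restrict (Ioi (0:ℝ)))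
    (f := id) (g := fun t => Real.exp (-l * t))
    (ae_restrict_of_forall_mem measurableSet_Ioi fun x hx => (mem_Ioi.1 hx).le)
    (by fun_prop)
    (fun t _ => (by fun_prop : Continuous fun t => Real.exp (-l * t)).intervalIntegrable _ _)
    (ae_of_all _ fun t => (Real.exp_pos _).le)
  have hprim : ∀ x : ℝ, ∫ t in (0:ℝ)..x, Real.exp (-l * t) = (1 - Real.exp (-l * x)) / l := by
    intro x
    rw [intervalIntegral.integral_comp_mul_left _ (neg_ne_zero.2 hl.ne'), integral_exp,
      smul_eq_mul]
    simp
    field_simp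
    ring
  rw [← integral_div, ofReal_integral_eq_lintegral_ofReal
    ((integrableOn_one_sub_exp hν hl).div_const l)
    (ae_restrict_of_forall_mem measurableSet_Ioi fun x hx =>
      div_nonneg (sub_nonneg.2 (Real.exp_le_one_iff.2 (by nlinarith [mem_Ioi.1 hx]))) hl.le)]
  simp only [id, hprim] at hcake
  rw [hcake]
  refine setLIntegral_congr_fun measurableSet_Ioi fun t ht => ?_
  have ht : 0 < t := ht
  have hset : {a : ℝ | t < a} = Ioi t := rfl
  rw [hset, Measure.restrict_apply measurableSet_Ioi,
    inter_eq_left.2 (Ioi_subset_Ioi ht.le),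
    ENNReal.ofReal_toReal (measure_Ioi_ne_top_of_lintegral_min hν ht), mul_comm]

theorem measurable_measure_Ioi_toReal (ν : Measure ℝ) :
    Measurable fun t => (ν (Ioi t)).toReal :=
  (Antitone.measurable fun _ _ h => measure_mono (Ioi_subset_Ioi h)).ennreal_toReal

end LevyMeasure

/-- Proposition 3.2.  With `q(t,x,y) = ∫₀^∞ p⁰(r,x,y) p̄(r,t) dr`,
`p(t,x,y) = ∫₀^t w(t−s) q(s,x,y) ds` and `G(t) = ∫₀^∞ p̄(r,t) dr` the potential density of
the subordinator, one has, for every `t > 0` and all `x,y ∈ E` (as an identity in `[0,∞]`):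
`∫₀^t q(s,x,y) ds = ∫₀^t G(t−s) p(s,x,y) ds`. -/
theorem time_frac_stmt8
    {E : Type*} [MeasurableSpace E]
    (ν : Measure ℝ)
    (hν_loc : ∫⁻ x in Set.Ioi (0:ℝ), ENNReal.ofReal (min 1 x) ∂ν ≠ ⊤)
    (hν_inf : ν (Set.Ioi (0:ℝ)) = ⊤)
    (φ : ℝ → ℝ)
    (hφ : ∀ l : ℝ, 0 < l → φ l = ∫ x in Set.Ioi (0:ℝ), (1 - Real.exp (-l * x)) ∂ν)
    (w : ℝ → ℝ)
    (hw : ∀ x : ℝ, w x = (ν (Set.Ioi x)).toReal)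
    (μr : ℝ → Measure ℝ)
    (hprob : ∀ r : ℝ, 0 < r → IsProbabilityMeasure (μr r))
    (hlap : ∀ r : ℝ, 0 < r → ∀ l : ℝ, 0 < l →
      ∫ s, Real.exp (-l * s) ∂(μr r) = Real.exp (-r * φ l))
    (pbar : ℝ → ℝ → ℝ)
    (hpbar_nn : ∀ r t : ℝ, 0 ≤ pbar r t)
    (hpbar_meas : Measurable (Function.uncurry pbar))
    (hpbar_bdd : ∀ r : ℝ, 0 < r → ∃ C : ℝ, ∀ t : ℝ, pbar r t ≤ C)
    (hdens : ∀ r : ℝ, 0 < r → ∀ A : Set ℝ, MeasurableSet A →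
      μr r A = ∫⁻ t in A ∩ Set.Ici 0, ENNReal.ofReal (pbar r t))
    -- the kernel p⁰ of the semigroup (Assumption 3.1)
    (p0 : ℝ → E → E → ℝ)
    (hp0_nn : ∀ r : ℝ, ∀ x y : E, 0 ≤ p0 r x y)
    (hp0_meas : Measurable (fun z : ℝ × E × E => p0 z.1 z.2.1 z.2.2))
    -- the fundamental solutions q and p, and the potential density G
    (q : ℝ → E → E → ℝ≥0∞)
    (hq : ∀ (t : ℝ) (x y : E),
      q t x y = ∫⁻ r in Set.Ioi (0:ℝ), ENNReal.ofReal (p0 r x y * pbar r t))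
    (p : ℝ → E → E → ℝ≥0∞)
    (hp : ∀ (t : ℝ) (x y : E),
      p t x y = ∫⁻ s in Set.Ioo (0:ℝ) t, ENNReal.ofReal (w (t - s)) * q s x y)
    (G : ℝ → ℝ≥0∞)
    (hG : ∀ t : ℝ, G t = ∫⁻ r in Set.Ioi (0:ℝ), ENNReal.ofReal (pbar r t)) :
    ∀ t : ℝ, 0 < t → ∀ x y : E,
      ∫⁻ s in Set.Ioo (0:ℝ) t, q s x y
        = ∫⁻ s in Set.Ioo (0:ℝ) t, G (t - s) * p s x y := by
  intro t ht x y
  have hφ_pos : ∀ l : ℝ, 0 < l → 0 < φ l := fun l hl => by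
    rw [hφ l hl]
    exact integral_one_sub_exp_pos hν_loc (by simp [hν_inf]) hl
  have hdensity : ∀ r : ℝ, 0 < r → μr r = (volume.restrict (Ioi (0:ℝ))).withDensity
      (fun t => ENNReal.ofReal (pbar r t)) := by
    intro r hr
    ext A hA
    rw [hdens r hr A hA, withDensity_apply _ hA, Measure.restrict_restrict hA]
    exact setLIntegral_congr ((ae_eq_refl A).inter Ioi_ae_eq_Ici.symm)
  have hpbar_lap : ∀ r : ℝ, 0 < r → ∀ l : ℝ, 0 < l →
      ∫⁻ t in Ioi (0:ℝ), ENNReal.ofReal (Real.exp (-l * t)) * ENNReal.ofReal (pbar r t)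
        = ENNReal.ofReal (Real.exp (-φ l * r)) := by
    intro r hr l hl
    have hint : Integrable (fun s => Real.exp (-l * s)) (μr r) := by
      refine not_imp_comm.1 integral_undef ?_
      rw [hlap r hr l hl]
      exact (Real.exp_pos _).ne'
    have h := hlap r hr l hl
    rw [neg_mul_comm r, mul_comm r] at h
    rw [← h, ofReal_integral_eq_lintegral_ofReal hint (ae_of_all _ fun s => (Real.exp_pos _).le),
      hdensity r hr, lintegral_withDensity_eq_lintegral_mul _ (by fun_prop) (by fun_prop)]
    exact lintegral_congr fun s => mul_comm _ _
  have hG_meas : Measurable G := by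
    rw [funext hG]
    exact Measurable.lintegral_prod_left' (f := fun z : ℝ × ℝ => ENNReal.ofReal (pbar z.1 z.2))
      hpbar_meas.ennreal_ofReal
  have hw_meas : Measurable w := by
    rw [funext hw]
    exact measurable_measure_Ioi_toReal ν
  have hq_meas : Measurable fun s => q s x y := by
    simp only [hq]
    have hp0 : Measurable fun r => p0 r x y :=
      hp0_meas.comp (g := fun z : ℝ × E × E => p0 z.1 z.2.1 z.2.2) (f := fun r => (r, x, y))
        (by fun_prop)
    exact Measurable.lintegral_prod_left'
      (f := fun z : ℝ × ℝ => ENNReal.ofReal (p0 z.1 x y * pbar z.1 z.2))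
      ((hp0.comp measurable_fst).mul hpbar_meas).ennreal_ofReal
  have hG_lap : ∀ l : ℝ, 0 < l →
      ∫⁻ t in Ioi (0:ℝ), ENNReal.ofReal (Real.exp (-l * t)) * G t = ENNReal.ofReal (1 / φ l) := by
    intro l hl
    calc ∫⁻ t in Ioi (0:ℝ), ENNReal.ofReal (Real.exp (-l * t)) * G t
        = ∫⁻ t in Ioi (0:ℝ), ∫⁻ r in Ioi (0:ℝ),
            ENNReal.ofReal (Real.exp (-l * t)) * ENNReal.ofReal (pbar r t) := by
          refine lintegral_congr fun t => ?_
          rw [hG, lintegral_const_mul _ (by fun_prop)]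
      _ = ∫⁻ r in Ioi (0:ℝ), ∫⁻ t in Ioi (0:ℝ),
            ENNReal.ofReal (Real.exp (-l * t)) * ENNReal.ofReal (pbar r t) :=
          lintegral_lintegral_swap (by fun_prop)
      _ = ∫⁻ r in Ioi (0:ℝ), ENNReal.ofReal (Real.exp (-φ l * r)) :=
          setLIntegral_congr_fun measurableSet_Ioi fun r hr => hpbar_lap r hr l hl
      _ = _ := lintegral_exp_neg_mul_Ioi (hφ_pos l hl)
  set g : ℝ → ℝ≥0∞ := (Ioi 0).indicator G with hg_def
  set k : ℝ → ℝ≥0∞ := (Ioi 0).indicator fun s => ENNReal.ofReal (w s) with hk_def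
  set u : ℝ → ℝ≥0∞ := (Ioi 0).indicator fun s => q s x y with hu_def
  have hg : Measurable g := hG_meas.indicator measurableSet_Ioi
  have hk : Measurable k := hw_meas.ennreal_ofReal.indicator measurableSet_Ioi
  have hu : Measurable u := hq_meas.indicator measurableSet_Ioi
  have hsupp : ∀ f h : ℝ → ℝ≥0∞, (Ioi 0).indicator f ⋆ₗ[volume] (Ioi 0).indicator h
      = (Ioi 0).indicator ((Ioi 0).indicator f ⋆ₗ[volume] (Ioi 0).indicator h) := by
    intro f h
    refine (indicator_eq_self.2 fun s hs => ?_).symm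
    by_contra hs0
    refine hs ?_
    rw [lconvolution_indicator_Ioi, Ioo_eq_empty hs0, Measure.restrict_empty,
      lintegral_zero_measure]
  have hgk : ∀ᵐ s, (g ⋆ₗ[volume] k) s = (Ioi (0:ℝ)).indicator 1 s := by
    have hlaplace := ae_eq_one_of_laplace (measurable_lconvolution volume hg hk) fun l hl => by
      rw [← lintegral_mul_indicator_Ioi, hg_def, hk_def, ← hsupp,
        lintegral_exp_mul_lconvolution hg hk, lintegral_mul_indicator_Ioi,
        lintegral_mul_indicator_Ioi, hG_lap l hl]
      simp only [hw]
      rw [lintegral_exp_mul_tail hν_loc hl, ← hφ l hl,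
        ← ENNReal.ofReal_mul (one_div_nonneg.2 (hφ_pos l hl).le)]
      congr 1
      have := (hφ_pos l hl).ne'
      field_simp
    filter_upwards [(ae_restrict_iff' measurableSet_Ioi).1 hlaplace] with s hs
    rw [hg_def, hk_def, hsupp]
    by_cases h0 : s ∈ Ioi (0:ℝ)
    · rw [indicator_of_mem h0, indicator_of_mem h0, hs h0, Pi.one_apply]
    · rw [indicator_of_notMem h0, indicator_of_notMem h0]
  have hp_conv : (Ioi 0).indicator (fun s => p s x y) = k ⋆ₗ[volume] u := by
    rw [hk_def, hu_def, hsupp]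
    congr 1
    ext s
    rw [hp, lconvolution_indicator_Ioi]
  calc ∫⁻ s in Ioo (0:ℝ) t, q s x y
      = ((Ioi (0:ℝ)).indicator 1 ⋆ₗ[volume] u) t := by
        rw [hu_def, lconvolution_indicator_Ioi]
        simp
    _ = ((g ⋆ₗ[volume] k) ⋆ₗ[volume] u) t := by
        refine lintegral_congr_ae ?_
        filter_upwards [hgk] with s hs
        rw [hs]
    _ = (g ⋆ₗ[volume] (k ⋆ₗ[volume] u)) t := by rw [lconvolution_assoc hg hk hu]
    _ = _ := by rw [← hp_conv, hg_def, lconvolution_indicator_Ioi]
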